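/- Let d ≥ 1 and α ∈ (0,2). There exists a constant C = C(d,α) ≥ 1 such that for all t > 0 and all (x,v) ∈ ℝ^d × ℝ^d, p_t(x,v) ≥ C^{-1} · t^{−2d/α − d} · 𝒩_{d+α}(t^{−1/α−1} x, t^{−1/α} v). In particular p_t is strictly positive. -/

import Mathlib

open MeasureTheory Real RealInnerProductSpace

/-- The kinetic heat kernel of `Δ_v^{α/2} + v·∇_x`, via its Fourier integral. -/
noncomputable def kinHeat (d : ℕ) (α t : ℝ) (x v : EuclideanSpace ℝ (Fin d)) : ℝ :=
  (2 * π) ^ (-(2 * (d : ℝ))) *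
    ∫ w : EuclideanSpace ℝ (Fin d) × EuclideanSpace ℝ (Fin d),
      Real.cos (⟪x, w.1⟫ + ⟪v, w.2⟫) *
        Real.exp (-∫ s in (0 : ℝ)..t, ‖s • w.1 + w.2‖ ^ α)

/-- The function `𝒩_β`. -/
noncomputable def kinN (d : ℕ) (β : ℝ) (x v : EuclideanSpace ℝ (Fin d)) : ℝ :=
  (1 + Real.sqrt (‖x‖ ^ 2 + ‖v‖ ^ 2)) ^ (-(1 + β)) *
    (1 + ⨅ s : Set.Icc (0 : ℝ) 1, ‖x - (s : ℝ) • v‖) ^ (1 - β)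

section CosineTransform

variable {E : Type*} [NormedAddCommGroup E] [InnerProductSpace ℝ E] [FiniteDimensional ℝ E]
  [MeasurableSpace E] [BorelSpace E]

/-- The cosine transform on phase space `E × E`. -/
noncomputable def cosTransform (f : E × E → ℝ) (z : E × E) : ℝ :=
  ∫ w : E × E, cos (⟪z.1, w.1⟫ + ⟪z.2, w.2⟫) * f w

/-- Integrable functions with pointwise nonnegative cosine transform. -/
def IsPosCos (f : E × E → ℝ) : Prop :=
  Integrable f ∧ ∀ z, 0 ≤ cosTransform f z

lemma integrable_cos_mul {f : E × E → ℝ} (hf : Integrable f) (z : E × E) :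
    Integrable fun w : E × E => cos (⟪z.1, w.1⟫ + ⟪z.2, w.2⟫) * f w := by
  refine hf.bdd_mul (c := 1) (Continuous.aestronglyMeasurable (by fun_prop)) ?_
  filter_upwards with w
  exact abs_cos_le_one _

lemma continuous_cosTransform {f : E × E → ℝ} (hf : Integrable f) :
    Continuous (cosTransform f) := by
  refine continuous_of_dominated (bound := fun w => ‖f w‖)
    (fun z => (integrable_cos_mul hf z).1) (fun z => ?_) hf.norm ?_
  · filter_upwards with w
    rw [norm_mul]
    exact mul_le_of_le_one_left (norm_nonneg _) (abs_cos_le_one _)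
  · filter_upwards with w
    fun_prop

lemma cosTransform_const_mul (c : ℝ) (f : E × E → ℝ) (z : E × E) :
    cosTransform (fun w => c * f w) z = c * cosTransform f z := by
  simp only [cosTransform, ← integral_const_mul]
  congr with w
  ring

/-- Fubini for the cosine transform of a superposition. -/
lemma cosTransform_integral_mul {Ω : Type*} [MeasurableSpace Ω] {M : Measure Ω} [SFinite M]
    {g : Ω → E × E → ℝ} (hg : Measurable (Function.uncurry g)) {C : ℝ}
    (hC : ∀ σ w, |g σ w| ≤ C) {k : Ω → ℝ} (hk : Integrable k M)
    {f : E × E → ℝ} (hf : Integrable f) (z : E × E) :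
    cosTransform (fun w => (∫ σ, g σ w * k σ ∂M) * f w) z =
      ∫ σ, cosTransform (fun w => g σ w * f w) z * k σ ∂M := by
  have hintg : Integrable (Function.uncurry fun (σ : Ω) (w : E × E) =>
      cos (⟪z.1, w.1⟫ + ⟪z.2, w.2⟫) * (g σ w * f w) * k σ) (M.prod volume) := by
    have h1 : Integrable (fun p : Ω × (E × E) => k p.1 * f p.2) (M.prod volume) := hk.mul_prod hf
    have h2 : Integrable (fun p : Ω × (E × E) =>
        (cos (⟪z.1, p.2.1⟫ + ⟪z.2, p.2.2⟫) * g p.1 p.2) * (k p.1 * f p.2)) (M.prod volume) := by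
      refine h1.bdd_mul (c := C) (Measurable.aestronglyMeasurable ?_) ?_
      · refine Measurable.mul ?_ hg
        exact (Continuous.measurable (f := fun w : E × E => cos (⟪z.1, w.1⟫ + ⟪z.2, w.2⟫))
          (by fun_prop)).comp measurable_snd
      · filter_upwards with p
        rw [norm_mul]
        exact (mul_le_of_le_one_left (norm_nonneg _) (abs_cos_le_one _)).trans (hC _ _)
    refine h2.congr (.of_forall fun p => ?_)
    simp only [Function.uncurry]
    ring
  have := integral_integral_swap hintg
  simp only [integral_mul_const] at this
  simp only [cosTransform]
  rw [this]
  congr with w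
  rw [← integral_mul_const, ← integral_const_mul]
  congr with σ
  ring

lemma cosTransform_cos_mul {f : E × E → ℝ} (hf : Integrable f) (y z : E × E) :
    cosTransform (fun w => cos (⟪y.1, w.1⟫ + ⟪y.2, w.2⟫) * f w) z =
      (cosTransform f (z - y) + cosTransform f (z + y)) / 2 := by
  simp only [cosTransform]
  rw [← integral_add (integrable_cos_mul hf _) (integrable_cos_mul hf _), ← integral_div]
  congr with w
  have e1 : ⟪(z - y).1, w.1⟫ + ⟪(z - y).2, w.2⟫ =
      (⟪z.1, w.1⟫ + ⟪z.2, w.2⟫) - (⟪y.1, w.1⟫ + ⟪y.2, w.2⟫) := by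
    simp only [Prod.fst_sub, Prod.snd_sub, inner_sub_left]; ring
  have e2 : ⟪(z + y).1, w.1⟫ + ⟪(z + y).2, w.2⟫ =
      (⟪z.1, w.1⟫ + ⟪z.2, w.2⟫) + (⟪y.1, w.1⟫ + ⟪y.2, w.2⟫) := by
    simp only [Prod.fst_add, Prod.snd_add, inner_add_left]; ring
  rw [e1, e2, cos_sub (⟪z.1, w.1⟫ + _), cos_add (⟪z.1, w.1⟫ + _) (⟪y.1, w.1⟫ + _)]
  ring

/-- The cosine transform of a jump intensity `k`. -/
noncomputable def jumpSymbol (k : E → ℝ) (ζ : E) : ℝ := ∫ w, cos ⟪w, ζ⟫ * k w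

/-- The jump symbol averaged along the free transport over unit time. -/
noncomputable def kinSymbol (k : E → ℝ) (w : E × E) : ℝ :=
  ∫ s in (0 : ℝ)..1, jumpSymbol k (s • w.1 + w.2)

lemma integrable_cos_inner_mul {k : E → ℝ} (hk : Integrable k) (ζ : E) :
    Integrable fun w => cos ⟪w, ζ⟫ * k w := by
  refine hk.bdd_mul (c := 1) (Continuous.aestronglyMeasurable (by fun_prop)) ?_
  filter_upwards with w
  exact abs_cos_le_one _

lemma continuous_jumpSymbol {k : E → ℝ} (hk : Integrable k) : Continuous (jumpSymbol k) := by
  refine continuous_of_dominated (bound := fun w => ‖k w‖)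
    (fun z => (integrable_cos_inner_mul hk z).1) (fun z => ?_) hk.norm ?_
  · filter_upwards with w
    rw [norm_mul]
    exact mul_le_of_le_one_left (norm_nonneg _) (abs_cos_le_one _)
  · filter_upwards with w
    fun_prop

lemma abs_jumpSymbol_le {k : E → ℝ} (hk0 : ∀ w, 0 ≤ k w) (hk : Integrable k) (ζ : E) :
    |jumpSymbol k ζ| ≤ ∫ w, k w := by
  rw [jumpSymbol, ← norm_eq_abs]
  refine (norm_integral_le_integral_norm _).trans ?_
  refine integral_mono (integrable_cos_inner_mul hk ζ).norm hk fun w => ?_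
  simp only [norm_mul, norm_eq_abs, abs_of_nonneg (hk0 w)]
  exact mul_le_of_le_one_left (hk0 w) (abs_cos_le_one _)

lemma continuous_kinSymbol {k : E → ℝ} (hk : Integrable k) : Continuous (kinSymbol k) := by
  have := continuous_jumpSymbol hk
  unfold kinSymbol
  refine intervalIntegral.continuous_parametric_intervalIntegral_of_continuous' ?_ 0 1
  simp only [Function.uncurry_def]
  fun_prop

lemma abs_kinSymbol_le {k : E → ℝ} (hk0 : ∀ w, 0 ≤ k w) (hk : Integrable k) (w : E × E) :
    |kinSymbol k w| ≤ ∫ w, k w := by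
  have := intervalIntegral.norm_integral_le_of_norm_le_const (a := (0 : ℝ)) (b := 1)
    (f := fun s => jumpSymbol k (s • w.1 + w.2)) (C := ∫ w, k w)
    fun s _ => abs_jumpSymbol_le hk0 hk _
  simpa [kinSymbol] using this

lemma integrable_jumpSymbol_mul {k : E → ℝ} (hk0 : ∀ w, 0 ≤ k w) (hk : Integrable k)
    {f : E × E → ℝ} (hf : Integrable f) (s : ℝ) :
    Integrable fun w : E × E => jumpSymbol k (s • w.1 + w.2) * f w := by
  have := continuous_jumpSymbol hk
  refine hf.bdd_mul (c := ∫ w, k w) (Continuous.aestronglyMeasurable (by fun_prop)) ?_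
  filter_upwards with w
  exact abs_jumpSymbol_le hk0 hk _

lemma cosTransform_jumpSymbol_mul {k : E → ℝ} (hk : Integrable k)
    {f : E × E → ℝ} (hf : Integrable f) (s : ℝ) (z : E × E) :
    cosTransform (fun w => jumpSymbol k (s • w.1 + w.2) * f w) z =
      ∫ y, (cosTransform f (z - (s • y, y)) + cosTransform f (z + (s • y, y))) / 2 * k y := by
  have := cosTransform_integral_mul (M := (volume : Measure E)) (C := 1)
    (g := fun (y : E) (w : E × E) => cos ⟪y, s • w.1 + w.2⟫) (k := k) (f := f)
    (by
      refine Continuous.measurable ?_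
      simp only [Function.uncurry_def]
      fun_prop) (fun _ _ => abs_cos_le_one _) hk hf z
  simp only [jumpSymbol]
  rw [this]
  congr with y
  rw [← cosTransform_cos_mul hf]
  simp only [inner_add_right, inner_smul_left, inner_smul_right]
  rfl

lemma integrable_shift_mul {k : E → ℝ} (hk : Integrable k)
    {f : E × E → ℝ} (hf : Integrable f) (s : ℝ) (z : E × E) :
    Integrable fun y =>
      (cosTransform f (z - (s • y, y)) + cosTransform f (z + (s • y, y))) / 2 * k y := by
  have := continuous_cosTransform hf
  refine hk.bdd_mul (c := ∫ w, ‖f w‖) (Continuous.aestronglyMeasurable (by fun_prop)) ?_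
  filter_upwards with y
  have hb : ∀ z, |cosTransform f z| ≤ ∫ w, ‖f w‖ := fun z => by
    rw [cosTransform, ← norm_eq_abs]
    refine (norm_integral_le_integral_norm _).trans ?_
    refine integral_mono (integrable_cos_mul hf z).norm hf.norm fun w => ?_
    simp only [norm_mul]
    exact mul_le_of_le_one_left (norm_nonneg _) (abs_cos_le_one _)
  rw [norm_eq_abs, abs_div, abs_two, div_le_iff₀ two_pos]
  linarith [abs_add_le (cosTransform f (z - (s • y, y))) (cosTransform f (z + (s • y, y))),
    hb (z - (s • y, y)), hb (z + (s • y, y))]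

lemma IsPosCos.jumpSymbol_mul {k : E → ℝ} (hk0 : ∀ w, 0 ≤ k w) (hk : Integrable k)
    {f : E × E → ℝ} (hf : IsPosCos f) (s : ℝ) :
    IsPosCos fun w : E × E => jumpSymbol k (s • w.1 + w.2) * f w := by
  refine ⟨integrable_jumpSymbol_mul hk0 hk hf.1 s, fun z => ?_⟩
  rw [cosTransform_jumpSymbol_mul hk hf.1]
  refine integral_nonneg fun y => mul_nonneg ?_ (hk0 y)
  exact div_nonneg (add_nonneg (hf.2 _) (hf.2 _)) two_pos.le

/-- One jump landing in a ball: quantitative positivity. -/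
lemma le_cosTransform_jumpSymbol_mul {k : E → ℝ} (hk0 : ∀ w, 0 ≤ k w) (hk : Integrable k)
    {f : E × E → ℝ} (hf : IsPosCos f) (s : ℝ) (z : E × E) (a : E) (ρ : ℝ) {A K : ℝ}
    (hA : 0 ≤ A) (hK : 0 ≤ K)
    (hfA : ∀ y ∈ Metric.ball a ρ, A ≤ cosTransform f (z - (s • y, y)))
    (hkK : ∀ y ∈ Metric.ball a ρ, K ≤ k y) :
    A / 2 * K * volume.real (Metric.ball (0 : E) ρ) ≤
      cosTransform (fun w => jumpSymbol k (s • w.1 + w.2) * f w) z := by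
  rw [cosTransform_jumpSymbol_mul hk hf.1]
  have hintg := integrable_shift_mul hk hf.1 s z
  have hvol : volume.real (Metric.ball (0 : E) ρ) = volume.real (Metric.ball a ρ) := by
    simp only [Measure.real, Measure.addHaar_ball_center]
  rw [hvol]
  calc A / 2 * K * volume.real (Metric.ball a ρ)
      = ∫ y in Metric.ball a ρ, A / 2 * K := by simp [mul_comm]
    _ ≤ ∫ y in Metric.ball a ρ,
        (cosTransform f (z - (s • y, y)) + cosTransform f (z + (s • y, y))) / 2 * k y := by
        refine setIntegral_mono_on (integrableOn_const measure_ball_lt_top.ne) hintg.integrableOn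
          Metric.isOpen_ball.measurableSet fun y hy => ?_
        have h1 := hfA y hy
        have h2 := hf.2 (z + (s • y, y))
        exact mul_le_mul (by linarith) (hkK y hy) hK (by linarith)
    _ ≤ _ := by
        refine setIntegral_le_integral hintg (.of_forall fun y => mul_nonneg ?_ (hk0 y))
        exact div_nonneg (add_nonneg (hf.2 _) (hf.2 _)) two_pos.le

lemma cosTransform_kinSymbol_mul {k : E → ℝ} (hk0 : ∀ w, 0 ≤ k w) (hk : Integrable k)
    {f : E × E → ℝ} (hf : Integrable f) (z : E × E) :
    cosTransform (fun w => kinSymbol k w * f w) z =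
      ∫ s in (0 : ℝ)..1, cosTransform (fun w => jumpSymbol k (s • w.1 + w.2) * f w) z := by
  have hc := continuous_jumpSymbol hk
  have := cosTransform_integral_mul (M := volume.restrict (Set.Ioc (0 : ℝ) 1)) (C := ∫ w, k w)
    (g := fun (s : ℝ) (w : E × E) => jumpSymbol k (s • w.1 + w.2)) (k := fun _ => 1) (f := f)
    (by
      refine Continuous.measurable ?_
      simp only [Function.uncurry_def]
      fun_prop) (fun _ _ => abs_jumpSymbol_le hk0 hk _) (integrable_const _) hf z
  simpa only [kinSymbol, intervalIntegral.integral_of_le zero_le_one, mul_one] using this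

lemma continuous_cosTransform_jumpSymbol_mul {k : E → ℝ} (hk0 : ∀ w, 0 ≤ k w)
    (hk : Integrable k) {f : E × E → ℝ} (hf : Integrable f) (z : E × E) :
    Continuous fun s : ℝ => cosTransform (fun w => jumpSymbol k (s • w.1 + w.2) * f w) z := by
  have hc := continuous_jumpSymbol hk
  refine continuous_of_dominated (bound := fun w => (∫ w, k w) * ‖f w‖)
    (fun s => (integrable_cos_mul (integrable_jumpSymbol_mul hk0 hk hf s) z).1) (fun s => ?_)
    (hf.norm.const_mul _) ?_
  · filter_upwards with w
    rw [norm_mul, norm_mul]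
    refine (mul_le_of_le_one_left (by positivity) (abs_cos_le_one _)).trans ?_
    gcongr
    exact abs_jumpSymbol_le hk0 hk _
  · filter_upwards with w
    fun_prop

lemma integrable_kinSymbol_mul {k : E → ℝ} (hk0 : ∀ w, 0 ≤ k w) (hk : Integrable k)
    {f : E × E → ℝ} (hf : Integrable f) : Integrable fun w => kinSymbol k w * f w := by
  refine hf.bdd_mul (c := ∫ w, k w) (continuous_kinSymbol hk).aestronglyMeasurable ?_
  filter_upwards with w
  exact abs_kinSymbol_le hk0 hk _

lemma IsPosCos.kinSymbol_mul {k : E → ℝ} (hk0 : ∀ w, 0 ≤ k w) (hk : Integrable k)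
    {f : E × E → ℝ} (hf : IsPosCos f) : IsPosCos fun w => kinSymbol k w * f w := by
  refine ⟨integrable_kinSymbol_mul hk0 hk hf.1, fun z => ?_⟩
  rw [cosTransform_kinSymbol_mul hk0 hk hf.1]
  exact intervalIntegral.integral_nonneg zero_le_one
    fun s _ => (hf.jumpSymbol_mul hk0 hk s).2 z

lemma IsPosCos.kinSymbol_pow_mul {k : E → ℝ} (hk0 : ∀ w, 0 ≤ k w) (hk : Integrable k)
    {f : E × E → ℝ} (hf : IsPosCos f) (n : ℕ) : IsPosCos fun w => kinSymbol k w ^ n * f w := by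
  induction n with
  | zero => simpa using hf
  | succ n ih =>
    have := ih.kinSymbol_mul hk0 hk
    simpa only [pow_succ', mul_assoc] using this

lemma integrable_exp_kinSymbol_mul {k : E → ℝ} (hk0 : ∀ w, 0 ≤ k w) (hk : Integrable k)
    {f : E × E → ℝ} (hf : Integrable f) : Integrable fun w => exp (kinSymbol k w) * f w := by
  refine hf.bdd_mul (c := exp (∫ w, k w))
    (continuous_kinSymbol hk).rexp.aestronglyMeasurable ?_
  filter_upwards with w
  rw [norm_eq_abs, abs_exp]
  exact exp_le_exp.2 ((le_abs_self _).trans (abs_kinSymbol_le hk0 hk _))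

lemma hasSum_cosTransform_exp {k : E → ℝ} (hk0 : ∀ w, 0 ≤ k w) (hk : Integrable k)
    {f : E × E → ℝ} (hf : IsPosCos f) (z : E × E) :
    HasSum (fun n : ℕ => ((n.factorial : ℝ))⁻¹ * cosTransform (fun w => kinSymbol k w ^ n * f w) z)
      (cosTransform (fun w => exp (kinSymbol k w) * f w) z) := by
  have hexp : ∀ x : ℝ, HasSum (fun n : ℕ => (n.factorial : ℝ)⁻¹ * x ^ n) (exp x) := fun x => by
    have := NormedSpace.expSeries_div_hasSum_exp x
    rw [← exp_eq_exp_ℝ] at this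
    simpa only [div_eq_inv_mul] using this
  set Λ := ∫ w, k w
  simp only [← cosTransform_const_mul]
  refine hasSum_integral_of_dominated_convergence
    (fun n w => ((n.factorial : ℝ)⁻¹ * Λ ^ n) * ‖f w‖) (fun n => ?_) (fun n => ?_) ?_ ?_ ?_
  · exact (integrable_cos_mul ((hf.kinSymbol_pow_mul hk0 hk n).1.const_mul _) z).1
  · filter_upwards with w
    rw [norm_mul, norm_mul, norm_mul, norm_pow, ← mul_assoc (‖(n.factorial : ℝ)⁻¹‖)]
    refine (mul_le_of_le_one_left (by positivity) (abs_cos_le_one _)).trans ?_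
    rw [norm_of_nonneg (by positivity : (0 : ℝ) ≤ (n.factorial : ℝ)⁻¹)]
    gcongr
    exact abs_kinSymbol_le hk0 hk w
  · filter_upwards with w
    exact (hexp Λ).summable.mul_right _
  · simp only [tsum_mul_right]
    exact hf.1.norm.const_mul _
  · filter_upwards with w
    have := ((hexp (kinSymbol k w)).mul_right (f w)).mul_left (cos (⟪z.1, w.1⟫ + ⟪z.2, w.2⟫))
    simpa only [mul_assoc] using this

lemma IsPosCos.half_sq_le_exp {k : E → ℝ} (hk0 : ∀ w, 0 ≤ k w) (hk : Integrable k)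
    {f : E × E → ℝ} (hf : IsPosCos f) (z : E × E) :
    cosTransform (fun w => kinSymbol k w ^ 2 * f w) z / 2 ≤
      cosTransform (fun w => exp (kinSymbol k w) * f w) z := by
  have := le_hasSum (hasSum_cosTransform_exp hk0 hk hf z) 2 fun n _ =>
    mul_nonneg (by positivity) ((hf.kinSymbol_pow_mul hk0 hk n).2 z)
  simpa [Nat.factorial, div_eq_inv_mul] using this

lemma IsPosCos.exp_mul {k : E → ℝ} (hk0 : ∀ w, 0 ≤ k w) (hk : Integrable k)
    {f : E × E → ℝ} (hf : IsPosCos f) : IsPosCos fun w => exp (kinSymbol k w) * f w :=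
  ⟨integrable_exp_kinSymbol_mul hk0 hk hf.1, fun z =>
    (div_nonneg ((hf.kinSymbol_pow_mul hk0 hk 2).2 z) two_pos.le).trans
      (hf.half_sq_le_exp hk0 hk z)⟩

lemma IsPosCos.const_mul {f : E × E → ℝ} (hf : IsPosCos f) {c : ℝ} (hc : 0 ≤ c) :
    IsPosCos fun w => c * f w :=
  ⟨hf.1.const_mul c, fun z => by
    rw [cosTransform_const_mul]
    exact mul_nonneg hc (hf.2 z)⟩

/-- Positivity of the cosine transform is stable under dominated limits. -/
lemma IsPosCos.of_tendsto {F : ℕ → E × E → ℝ} {f b : E × E → ℝ} (hF : ∀ n, IsPosCos (F n))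
    (hb : Integrable b) (hFb : ∀ n w, |F n w| ≤ b w)
    (hlim : ∀ w, Filter.Tendsto (fun n => F n w) Filter.atTop (nhds (f w))) : IsPosCos f := by
  have hfm : AEStronglyMeasurable f volume :=
    aestronglyMeasurable_of_tendsto_ae Filter.atTop (fun n => (hF n).1.1) (.of_forall hlim)
  refine ⟨hb.mono' hfm (.of_forall fun w => ?_), fun z => ?_⟩
  · exact le_of_tendsto (hlim w).abs (.of_forall fun n => hFb n w)
  · refine ge_of_tendsto (x := Filter.atTop) (f := fun n => cosTransform (F n) z) ?_
      (.of_forall fun n => (hF n).2 z)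
    refine tendsto_integral_of_dominated_convergence b
      (fun n => (integrable_cos_mul (hF n).1 z).1) hb (fun n => .of_forall fun w => ?_)
      (.of_forall fun w => (hlim w).const_mul _)
    rw [norm_mul]
    exact (mul_le_of_le_one_left (norm_nonneg _) (abs_cos_le_one _)).trans (hFb n w)

lemma isPosCos_gaussian {b : ℝ} (hb : 0 < b) :
    IsPosCos fun w : E × E => exp (-b * ‖w.1‖ ^ 2) * exp (-b * ‖w.2‖ ^ 2) := by
  have key : ∀ x : E, (fun v : E => Complex.exp (-(b : ℂ) * (‖v‖ : ℂ) ^ 2 + Complex.I * (⟪x, v⟫ : ℝ)))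
      = fun v => Complex.exp (Complex.I * (⟪x, v⟫ : ℝ)) * ((exp (-b * ‖v‖ ^ 2) : ℝ) : ℂ) := by
    intro x
    ext v
    rw [Complex.ofReal_exp, ← Complex.exp_add]
    push_cast
    ring_nf
  have hbre : 0 < (b : ℂ).re := by simpa
  have hintg : Integrable fun v : E => exp (-b * ‖v‖ ^ 2) := by
    have := (GaussianFourier.integrable_cexp_neg_mul_sq_norm_add hbre 0 (0 : E)).re
    refine this.congr (.of_forall fun v => ?_)
    have : (-(b : ℂ) * (‖v‖ : ℂ) ^ 2 + 0 * ((⟪(0 : E), v⟫ : ℝ) : ℂ)) =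
      ((-b * ‖v‖ ^ 2 : ℝ) : ℂ) := by push_cast; ring
    simp only
    rw [this, ← Complex.ofReal_exp]
    rfl
  have hval : ∀ x : E, ∃ c : ℝ, 0 ≤ c ∧
      ∫ v : E, Complex.exp (Complex.I * (⟪x, v⟫ : ℝ)) * ((exp (-b * ‖v‖ ^ 2) : ℝ) : ℂ) = c := by
    intro x
    refine ⟨(π / b) ^ ((Module.finrank ℝ E : ℝ) / 2) * exp (-‖x‖ ^ 2 / (4 * b)), by positivity, ?_⟩
    rw [← key, GaussianFourier.integral_cexp_neg_mul_sq_norm_add hbre]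
    push_cast
    rw [Complex.ofReal_cpow (by positivity)]
    push_cast
    rw [Complex.I_sq]
    ring_nf
  refine ⟨hintg.mul_prod hintg, fun z => ?_⟩
  obtain ⟨c₁, hc₁, h₁⟩ := hval z.1
  obtain ⟨c₂, hc₂, h₂⟩ := hval z.2
  have hprod := integral_prod_mul (μ := (volume : Measure E)) (ν := (volume : Measure E))
    (fun v : E => Complex.exp (Complex.I * (⟪z.1, v⟫ : ℝ)) * ((exp (-b * ‖v‖ ^ 2) : ℝ) : ℂ))
    (fun v : E => Complex.exp (Complex.I * (⟪z.2, v⟫ : ℝ)) * ((exp (-b * ‖v‖ ^ 2) : ℝ) : ℂ))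
  rw [h₁, h₂] at hprod
  have hcint : ∀ x : E, Integrable fun v : E =>
      Complex.exp (Complex.I * (⟪x, v⟫ : ℝ)) * ((exp (-b * ‖v‖ ^ 2) : ℝ) : ℂ) := fun x => by
    rw [← key]
    exact GaussianFourier.integrable_cexp_neg_mul_sq_norm_add hbre _ x
  have hre := integral_re ((hcint z.1).mul_prod (hcint z.2))
  have : cosTransform (fun w : E × E => exp (-b * ‖w.1‖ ^ 2) * exp (-b * ‖w.2‖ ^ 2)) z =
      c₁ * c₂ := by
    rw [← Measure.volume_eq_prod] at hprod hre
    rw [hprod, ← Complex.ofReal_mul] at hre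
    refine Eq.trans ?_ hre
    unfold cosTransform
    congr with w
    have : Complex.exp (Complex.I * (⟪z.1, w.1⟫ : ℝ)) * ((exp (-b * ‖w.1‖ ^ 2) : ℝ) : ℂ) *
        (Complex.exp (Complex.I * (⟪z.2, w.2⟫ : ℝ)) * ((exp (-b * ‖w.2‖ ^ 2) : ℝ) : ℂ)) =
        ((exp (-b * ‖w.1‖ ^ 2) * exp (-b * ‖w.2‖ ^ 2) : ℝ) : ℂ) *
          Complex.exp (((⟪z.1, w.1⟫ + ⟪z.2, w.2⟫ : ℝ) : ℂ) * Complex.I) := by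
      push_cast
      rw [add_mul, Complex.exp_add, mul_comm Complex.I, mul_comm Complex.I]
      ring
    rw [this]
    simp only [RCLike.re_eq_complex_re]
    rw [Complex.re_ofReal_mul, Complex.exp_ofReal_mul_I_re, mul_comm]
  rw [this]
  positivity

end CosineTransform

section StableSymbol

open Module

lemma one_sub_cos_le_min (x : ℝ) : 1 - cos x ≤ 2 * min 1 (x ^ 2) := by
  rw [mul_min_of_nonneg _ _ two_pos.le]
  refine le_min ?_ ?_
  · linarith [neg_one_le_cos x]
  · nlinarith [one_sub_sq_div_two_le_cos (x := x)]

/-- The finite jump intensity obtained by regularising the `α`-stable one at scale `ε`. -/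
noncomputable def regJump (E : Type*) [NormedAddCommGroup E] (β κ ε : ℝ) (w : E) : ℝ :=
  κ⁻¹ * (ε + ‖w‖) ^ (-β)

lemma regJump_nonneg {E : Type*} [NormedAddCommGroup E] {β κ ε : ℝ} (hκ : 0 < κ) (hε : 0 < ε) (w : E) : 0 ≤ regJump E β κ ε w := by
  unfold regJump
  positivity

lemma regJump_anti {E : Type*} [NormedAddCommGroup E] {β κ ε ε' : ℝ} (hβ : 0 ≤ β) (hκ : 0 < κ) (hε : 0 < ε) (h : ε ≤ ε') (w : E) :
    regJump E β κ ε' w ≤ regJump E β κ ε w := by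
  unfold regJump
  have := rpow_le_rpow_of_nonpos (z := -β) (by positivity : 0 < ε + ‖w‖)
    (by linarith : ε + ‖w‖ ≤ ε' + ‖w‖) (by linarith)
  gcongr

/-- The action of the free transport on the `α`-stable symbol over unit time. -/
noncomputable def kinAction {E : Type*} [NormedAddCommGroup E] [InnerProductSpace ℝ E] (α : ℝ) (w : E × E) : ℝ :=
  ∫ s in (0 : ℝ)..1, ‖s • w.1 + w.2‖ ^ α

lemma continuous_kinAction {E : Type*} [NormedAddCommGroup E] [InnerProductSpace ℝ E] {α : ℝ} (hα : 0 < α) : Continuous (kinAction (E := E) α) := by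
  unfold kinAction
  refine intervalIntegral.continuous_parametric_intervalIntegral_of_continuous' ?_ 0 1
  simp only [Function.uncurry_def]
  exact Continuous.rpow_const (by fun_prop) fun _ => Or.inr hα.le

/-- Coercivity of the kinetic action: this is where the transport regularises in `x`. -/
lemma le_kinAction {E : Type*} [NormedAddCommGroup E] [InnerProductSpace ℝ E] {α : ℝ} (hα : 0 < α) (w : E × E) :
    1 / 2 * (8⁻¹ * ‖w‖) ^ α ≤ kinAction α w := by
  obtain ⟨ξ, η⟩ := w
  have hcont : Continuous fun s : ℝ => ‖s • ξ + η‖ ^ α :=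
    Continuous.rpow_const (by fun_prop) fun _ => Or.inr hα.le
  unfold kinAction
  simp only
  rcases le_total (2 * ‖ξ‖) ‖η‖ with h | h
  · have hN : ‖(ξ, η)‖ = ‖η‖ := by
      rw [Prod.norm_mk]
      exact max_eq_right (by linarith [norm_nonneg ξ])
    have : ∫ s in (0 : ℝ)..1, 1 / 2 * (8⁻¹ * ‖η‖) ^ α ≤ ∫ s in (0 : ℝ)..1, ‖s • ξ + η‖ ^ α := by
      refine intervalIntegral.integral_mono_on zero_le_one
        intervalIntegrable_const (hcont.intervalIntegrable _ _) fun s hs => ?_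
      have h1 : ‖η‖ ≤ ‖s • ξ + η‖ + ‖s • ξ‖ := by
        simpa using norm_sub_le (s • ξ + η) (s • ξ)
      have h2 : ‖s • ξ‖ ≤ ‖ξ‖ := by
        rw [norm_smul, norm_of_nonneg hs.1]
        exact mul_le_of_le_one_left (norm_nonneg _) hs.2
      have h3 : (8⁻¹ * ‖η‖) ^ α ≤ ‖s • ξ + η‖ ^ α := by
        gcongr
        linarith [norm_nonneg η]
      have h4 : 0 ≤ (8⁻¹ * ‖η‖) ^ α := by positivity
      linarith
    simpa [hN] using this
  · have hN : ‖(ξ, η)‖ ≤ 2 * ‖ξ‖ := by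
      rw [Prod.norm_mk]
      exact max_le (by linarith [norm_nonneg ξ]) h
    have hsplit := intervalIntegral.integral_add_adjacent_intervals
      (hcont.intervalIntegrable (μ := volume) 0 (1 / 2)) (hcont.intervalIntegrable (1 / 2) 1)
    have hshift := intervalIntegral.integral_comp_add_right (a := 0) (b := 1 / 2)
      (fun s : ℝ => ‖s • ξ + η‖ ^ α) (1 / 2)
    norm_num at hshift
    rw [← hsplit]
    norm_num
    have hcont' : Continuous fun s : ℝ => ‖(s + 1 / 2) • ξ + η‖ ^ α :=
      Continuous.rpow_const (by fun_prop) fun _ => Or.inr hα.le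
    rw [← hshift, ← intervalIntegral.integral_add (hcont.intervalIntegrable _ _)
      (hcont'.intervalIntegrable _ _)]
    have : ∫ s in (0 : ℝ)..(1 / 2), (8⁻¹ * ‖(ξ, η)‖) ^ α ≤
        ∫ s in (0 : ℝ)..(1 / 2), (‖s • ξ + η‖ ^ α + ‖(s + 1 / 2) • ξ + η‖ ^ α) := by
      refine intervalIntegral.integral_mono_on (by norm_num) intervalIntegrable_const
        ((hcont.add hcont').intervalIntegrable _ _)
        fun s hs => ?_
      have h1 : ‖ξ‖ / 2 ≤ ‖(s + 1 / 2) • ξ + η‖ + ‖s • ξ + η‖ := by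
        have := norm_sub_le ((s + 1 / 2) • ξ + η) (s • ξ + η)
        rw [show (s + 1 / 2) • ξ + η - (s • ξ + η) = (1 / 2 : ℝ) • ξ by module, norm_smul] at this
        norm_num at this
        linarith
      have hp1 : 0 ≤ ‖s • ξ + η‖ ^ α := by positivity
      have hp2 : 0 ≤ ‖(s + 1 / 2) • ξ + η‖ ^ α := by positivity
      rcases le_total (‖ξ‖ / 4) ‖s • ξ + η‖ with h2 | h2
      · have : (8⁻¹ * ‖(ξ, η)‖) ^ α ≤ ‖s • ξ + η‖ ^ α := by
          gcongr
          linarith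
        linarith
      · have : (8⁻¹ * ‖(ξ, η)‖) ^ α ≤ ‖(s + 1 / 2) • ξ + η‖ ^ α := by
          gcongr
          linarith
        linarith
    norm_num at this ⊢
    exact this

variable {E : Type*} [NormedAddCommGroup E] [InnerProductSpace ℝ E] [FiniteDimensional ℝ E]
  [MeasurableSpace E] [BorelSpace E]

lemma integrable_min_one_sq_mul_rpow [Nontrivial E] {α : ℝ} (hα : α ∈ Set.Ioo (0 : ℝ) 2) :
    Integrable fun w : E => min 1 (‖w‖ ^ 2) * ‖w‖ ^ (-((finrank ℝ E : ℝ) + α)) := by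
  have hd : 1 ≤ finrank ℝ E := finrank_pos
  rw [integrable_fun_norm_addHaar volume
    (f := fun r : ℝ => min 1 (r ^ 2) * r ^ (-((finrank ℝ E : ℝ) + α)))]
  have hpow : ∀ y : ℝ, 0 < y → y ^ (finrank ℝ E - 1) * y ^ (-((finrank ℝ E : ℝ) + α)) =
      y ^ (-1 - α) := fun y hy => by
    rw [← rpow_natCast, ← rpow_add hy]
    congr 1
    push_cast [hd]
    ring
  rw [← Set.Ioc_union_Ioi_eq_Ioi zero_le_one]
  refine IntegrableOn.union ?_ ?_
  · have h := (intervalIntegral.intervalIntegrable_rpow' (a := 0) (b := 1)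
      (r := 1 - α) (by linarith [hα.2])).1
    refine h.congr_fun (fun y hy => ?_) measurableSet_Ioc
    have h1 : y ^ 2 ≤ 1 := pow_le_one₀ hy.1.le hy.2
    simp only [smul_eq_mul, min_eq_right h1]
    rw [mul_left_comm, hpow y hy.1, ← rpow_natCast, ← rpow_add hy.1]
    congr 1
    push_cast
    ring
  · refine (integrableOn_Ioi_rpow_of_lt (a := -1 - α) (by linarith [hα.1]) zero_lt_one).congr_fun
      (fun y hy => ?_) measurableSet_Ioi
    have hy' : (1 : ℝ) < y := hy
    have h1 : 1 ≤ y ^ 2 := one_le_pow₀ hy'.le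
    simp only [smul_eq_mul, min_eq_left h1, one_mul]
    rw [hpow y (by linarith)]

lemma integrable_stableSymbol [Nontrivial E] {α : ℝ} (hα : α ∈ Set.Ioo (0 : ℝ) 2) (ζ : E) :
    Integrable fun w : E => (1 - cos ⟪w, ζ⟫) * ‖w‖ ^ (-((finrank ℝ E : ℝ) + α)) := by
  refine ((integrable_min_one_sq_mul_rpow hα).const_mul (2 * (1 + ‖ζ‖ ^ 2))).mono'
    (Measurable.aestronglyMeasurable (by fun_prop)) (.of_forall fun w => ?_)
  have h0 : 0 ≤ 1 - cos ⟪w, ζ⟫ := sub_nonneg.2 (cos_le_one _)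
  rw [norm_of_nonneg (by positivity), ← mul_assoc]
  gcongr
  refine (one_sub_cos_le_min _).trans ?_
  rw [mul_assoc]
  gcongr
  rw [mul_min_of_nonneg _ _ (by positivity)]
  refine le_min ((min_le_left _ _).trans (by nlinarith [sq_nonneg ‖ζ‖]))
    ((min_le_right _ _).trans ?_)
  have := abs_real_inner_le_norm w ζ
  calc ⟪w, ζ⟫ ^ 2 = |⟪w, ζ⟫| ^ 2 := (sq_abs _).symm
    _ ≤ (‖w‖ * ‖ζ‖) ^ 2 := by gcongr
    _ ≤ _ := by nlinarith [sq_nonneg ‖w‖]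

/-- The symbol of the rotation-invariant `α`-stable jump measure is a multiple of `‖ζ‖ ^ α`. -/
lemma exists_stableSymbol_eq [Nontrivial E] {α : ℝ} (hα : α ∈ Set.Ioo (0 : ℝ) 2) :
    ∃ κ > (0 : ℝ), ∀ ζ : E,
      ∫ w : E, (1 - cos ⟪w, ζ⟫) * ‖w‖ ^ (-((finrank ℝ E : ℝ) + α)) = κ * ‖ζ‖ ^ α := by
  set β : ℝ := (finrank ℝ E : ℝ) + α with hβ
  obtain ⟨e, he⟩ := exists_norm_eq E zero_le_one
  set J : E → ℝ := fun ζ => ∫ w : E, (1 - cos ⟪w, ζ⟫) * ‖w‖ ^ (-β) with hJ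
  have hnn : ∀ ζ w : E, 0 ≤ (1 - cos ⟪w, ζ⟫) * ‖w‖ ^ (-β) := fun ζ w =>
    mul_nonneg (sub_nonneg.2 (cos_le_one _)) (by positivity)
  have hpos : 0 < J e := by
    rw [hJ, integral_pos_iff_support_of_nonneg (hnn e) (integrable_stableSymbol hα e)]
    have hopen : IsOpen {w : E | cos ⟪w, e⟫ < 1} := isOpen_lt (by fun_prop) continuous_const
    refine (hopen.measure_pos volume ⟨e, ?_⟩).trans_le (measure_mono fun w hw => ?_)
    · simp only [Set.mem_ofPred_eq, real_inner_self_eq_norm_sq, he]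
      simpa using cos_one_le.trans_lt (by norm_num)
    · have hw' : cos ⟪w, e⟫ < 1 := hw
      have hw0 : w ≠ 0 := by
        rintro rfl
        simp at hw'
      exact (mul_pos (sub_pos.2 hw') (rpow_pos_of_pos (norm_pos_iff.2 hw0) _)).ne'
  have hrot : ∀ u : E, ‖u‖ = 1 → J u = J e := fun u hu => by
    set R := (ℝ ∙ (u - e))ᗮ.reflection
    have hR : R u = e := Submodule.reflection_sub (hu.trans he.symm)
    have := R.measurePreserving.integral_comp' (f := R.toMeasurableEquiv)
      (fun w => (1 - cos ⟪w, e⟫) * ‖w‖ ^ (-β))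
    rw [hJ]
    simp only
    rw [← this]
    congr with w
    rw [← hR]
    simp
  have hscale : ∀ (r : ℝ), 0 < r → ∀ ζ : E, J (r • ζ) = r ^ α * J ζ := fun r hr ζ => by
    have h := Measure.integral_comp_smul (volume : Measure E)
      (fun w => (1 - cos ⟪w, ζ⟫) * ‖w‖ ^ (-β)) r
    have h1 : ∀ w : E, (1 - cos ⟪r • w, ζ⟫) * ‖r • w‖ ^ (-β) =
        r ^ (-β) * ((1 - cos ⟪w, r • ζ⟫) * ‖w‖ ^ (-β)) := fun w => by
      rw [norm_smul, norm_of_nonneg hr.le, mul_rpow hr.le (norm_nonneg _), inner_smul_left,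
        inner_smul_right]
      simp only [conj_trivial]
      ring
    simp only [h1, integral_const_mul, smul_eq_mul] at h
    rw [abs_of_pos (by positivity)] at h
    change r ^ (-β) * J (r • ζ) = (r ^ finrank ℝ E)⁻¹ * J ζ at h
    have h2 : r ^ α = r ^ β * (r ^ finrank ℝ E)⁻¹ := by
      rw [← rpow_natCast, ← rpow_neg hr.le, ← rpow_add hr]
      congr 1
      rw [hβ]
      ring
    rw [h2, mul_assoc, ← h, ← mul_assoc, ← rpow_add hr]
    simp
  refine ⟨J e, hpos, fun ζ => ?_⟩
  rcases eq_or_ne ζ 0 with rfl | hζ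
  · simp [zero_rpow hα.1.ne']
  · have hn := norm_pos_iff.2 hζ
    have h1 : ζ = ‖ζ‖ • (‖ζ‖⁻¹ • ζ) := by rw [smul_smul, mul_inv_cancel₀ hn.ne', one_smul]
    have h2 : ‖‖ζ‖⁻¹ • ζ‖ = 1 := by
      rw [norm_smul, norm_inv, norm_norm, inv_mul_cancel₀ hn.ne']
    change J ζ = _
    rw [h1, hscale _ hn, hrot _ h2, ← h1, mul_comm]

lemma integrable_regJump {β κ ε : ℝ} (hβ : (finrank ℝ E : ℝ) < β) (hκ : 0 < κ) (hε : 0 < ε)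
    (hε1 : ε ≤ 1) : Integrable (regJump E β κ ε) := by
  refine ((integrable_one_add_norm (E := E) (μ := volume) hβ).const_mul (κ⁻¹ * ε ^ (-β))).mono'
    (Measurable.aestronglyMeasurable (by unfold regJump; fun_prop)) (.of_forall fun w => ?_)
  have hβ0 : 0 ≤ β := (Nat.cast_nonneg _).trans hβ.le
  rw [norm_of_nonneg (regJump_nonneg hκ hε w), regJump, mul_assoc,
    ← mul_rpow hε.le (by positivity)]
  have := rpow_le_rpow_of_nonpos (z := -β) (by positivity : 0 < ε * (1 + ‖w‖))
    (by nlinarith [norm_nonneg w] : ε * (1 + ‖w‖) ≤ ε + ‖w‖) (by linarith)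
  gcongr

lemma integrable_exp_neg_mul_norm_rpow {F : Type*} [NormedAddCommGroup F] [NormedSpace ℝ F]
    [FiniteDimensional ℝ F] [Nontrivial F] [MeasurableSpace F] [BorelSpace F] (μ : Measure F)
    [μ.IsAddHaarMeasure] {α b : ℝ} (hα : 0 < α) (hb : 0 < b) :
    Integrable (fun w : F => exp (-b * ‖w‖ ^ α)) μ := by
  rw [integrable_fun_norm_addHaar μ (f := fun r => exp (-b * r ^ α))]
  have := integrableOn_rpow_mul_exp_neg_mul_rpow (p := α) (b := b)
    (s := ((finrank ℝ F - 1 : ℕ) : ℝ)) (by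
      have : (0 : ℝ) ≤ ((finrank ℝ F - 1 : ℕ) : ℝ) := Nat.cast_nonneg _
      linarith) hα hb
  simpa only [rpow_natCast, smul_eq_mul] using this

lemma integrable_exp_neg_kinAction [Nontrivial E] {α : ℝ} (hα : 0 < α) :
    Integrable fun w : E × E => exp (-kinAction α w) := by
  have : (volume : Measure (E × E)).IsAddHaarMeasure :=
    inferInstanceAs ((volume : Measure E).prod (volume : Measure E)).IsAddHaarMeasure
  have h := integrable_exp_neg_mul_norm_rpow (volume : Measure (E × E)) hα
    (b := 1 / 2 * (8⁻¹ : ℝ) ^ α) (by positivity)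
  refine h.mono' (continuous_kinAction hα).neg.rexp.aestronglyMeasurable (.of_forall fun w => ?_)
  rw [norm_eq_abs, abs_exp, exp_le_exp]
  have := le_kinAction hα w
  rw [mul_rpow (by norm_num) (norm_nonneg _)] at this
  linarith

lemma tendsto_regJump_symbol [Nontrivial E] {α : ℝ} (hα : α ∈ Set.Ioo (0 : ℝ) 2) {κ : ℝ}
    (hκ : 0 < κ)
    (hsym : ∀ ζ : E, ∫ w : E, (1 - cos ⟪w, ζ⟫) * ‖w‖ ^ (-((finrank ℝ E : ℝ) + α)) = κ * ‖ζ‖ ^ α)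
    (ζ : E) :
    Filter.Tendsto (fun n : ℕ =>
      (∫ w, regJump E ((finrank ℝ E : ℝ) + α) κ (1 / (n + 1)) w) -
        jumpSymbol (regJump E ((finrank ℝ E : ℝ) + α) κ (1 / (n + 1))) ζ)
      Filter.atTop (nhds (‖ζ‖ ^ α)) ∧
    ∀ n : ℕ, |(∫ w, regJump E ((finrank ℝ E : ℝ) + α) κ (1 / (n + 1)) w) -
        jumpSymbol (regJump E ((finrank ℝ E : ℝ) + α) κ (1 / (n + 1))) ζ| ≤ ‖ζ‖ ^ α := by
  set β : ℝ := (finrank ℝ E : ℝ) + α with hβ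
  have hd : (0 : ℝ) ≤ (finrank ℝ E : ℝ) := Nat.cast_nonneg _
  have hε : ∀ n : ℕ, 0 < (1 : ℝ) / (n + 1) := fun n => by positivity
  have hε1 : ∀ n : ℕ, (1 : ℝ) / (n + 1) ≤ 1 := fun n => by
    rw [div_le_one (by positivity)]
    linarith [(Nat.cast_nonneg n : (0 : ℝ) ≤ n)]
  have hintg : ∀ n : ℕ, Integrable (regJump E β κ (1 / (n + 1))) := fun n =>
    integrable_regJump (by rw [hβ]; linarith [hα.1]) hκ (hε n) (hε1 n)
  have heq : ∀ n : ℕ, (∫ w, regJump E β κ (1 / (n + 1)) w) -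
      jumpSymbol (regJump E β κ (1 / (n + 1))) ζ =
      ∫ w, (1 - cos ⟪w, ζ⟫) * regJump E β κ (1 / (n + 1)) w := fun n => by
    rw [jumpSymbol, ← integral_sub (hintg n) (integrable_cos_inner_mul (hintg n) ζ)]
    congr with w
    ring
  have hval : ‖ζ‖ ^ α = ∫ w, κ⁻¹ * ((1 - cos ⟪w, ζ⟫) * ‖w‖ ^ (-β)) := by
    rw [integral_const_mul, hsym, inv_mul_cancel_left₀ hκ.ne']
  have hbi := (integrable_stableSymbol hα ζ).const_mul κ⁻¹
  have h0 : ∀ w : E, 0 ≤ 1 - cos ⟪w, ζ⟫ := fun w => sub_nonneg.2 (cos_le_one _)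
  have hmeas : ∀ n : ℕ, AEStronglyMeasurable
      (fun w => (1 - cos ⟪w, ζ⟫) * regJump E β κ (1 / (n + 1)) w) volume := fun n =>
    Measurable.aestronglyMeasurable (by unfold regJump; fun_prop)
  have hae : ∀ᵐ w : E, w ≠ 0 := by simp [ae_iff]
  have hbound : ∀ n : ℕ, ∀ᵐ w : E, ‖(1 - cos ⟪w, ζ⟫) * regJump E β κ (1 / (n + 1)) w‖ ≤
      κ⁻¹ * ((1 - cos ⟪w, ζ⟫) * ‖w‖ ^ (-β)) := fun n => by
    filter_upwards [hae] with w hw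
    rw [norm_of_nonneg (mul_nonneg (h0 w) (regJump_nonneg hκ (hε n) w)), mul_left_comm, regJump]
    have := h0 w
    have := rpow_le_rpow_of_nonpos (z := -β) (norm_pos_iff.2 hw)
      (by linarith [hε n] : ‖w‖ ≤ 1 / (n + 1) + ‖w‖) (by rw [hβ]; linarith [hα.1])
    gcongr
  simp only [heq]
  refine ⟨?_, fun n => ?_⟩
  · rw [hval]
    refine tendsto_integral_of_dominated_convergence _ hmeas hbi hbound ?_
    filter_upwards [hae] with w hw
    rw [mul_left_comm]
    refine Filter.Tendsto.const_mul _ (Filter.Tendsto.const_mul _ ?_)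
    have h1 : Filter.Tendsto (fun n : ℕ => 1 / ((n : ℝ) + 1) + ‖w‖) Filter.atTop (nhds ‖w‖) := by
      simpa using tendsto_one_div_add_atTop_nhds_zero_nat.add_const ‖w‖
    exact h1.rpow_const (Or.inl (norm_pos_iff.2 hw).ne')
  · rw [hval]
    exact (norm_integral_le_of_norm_le hbi (hbound n))

lemma tendsto_regJump_kinSymbol [Nontrivial E] {α : ℝ} (hα : α ∈ Set.Ioo (0 : ℝ) 2) {κ : ℝ}
    (hκ : 0 < κ)
    (hsym : ∀ ζ : E, ∫ w : E, (1 - cos ⟪w, ζ⟫) * ‖w‖ ^ (-((finrank ℝ E : ℝ) + α)) = κ * ‖ζ‖ ^ α)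
    (w : E × E) :
    Filter.Tendsto (fun n : ℕ =>
      (∫ y, regJump E ((finrank ℝ E : ℝ) + α) κ (1 / (n + 1)) y) -
        kinSymbol (regJump E ((finrank ℝ E : ℝ) + α) κ (1 / (n + 1))) w)
      Filter.atTop (nhds (kinAction α w)) := by
  set β : ℝ := (finrank ℝ E : ℝ) + α with hβ
  have hintg : ∀ n : ℕ, Integrable (regJump E β κ (1 / (n + 1))) := fun n =>
    integrable_regJump (by rw [hβ]; linarith [hα.1]) hκ (by positivity) (by
      rw [div_le_one (by positivity)]
      linarith [(Nat.cast_nonneg n : (0 : ℝ) ≤ n)])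
  have hcont : ∀ n : ℕ, Continuous fun s : ℝ =>
      jumpSymbol (regJump E β κ (1 / (n + 1))) (s • w.1 + w.2) := fun n =>
    (continuous_jumpSymbol (hintg n)).comp (by fun_prop)
  have heq : ∀ n : ℕ, (∫ y, regJump E β κ (1 / (n + 1)) y) -
      kinSymbol (regJump E β κ (1 / (n + 1))) w =
      ∫ s in (0 : ℝ)..1, ((∫ y, regJump E β κ (1 / (n + 1)) y) -
        jumpSymbol (regJump E β κ (1 / (n + 1))) (s • w.1 + w.2)) := fun n => by
    rw [intervalIntegral.integral_sub intervalIntegrable_const ((hcont n).intervalIntegrable _ _)]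
    simp [kinSymbol]
  simp only [heq]
  refine intervalIntegral.tendsto_integral_filter_of_dominated_convergence
    (fun s : ℝ => ‖s • w.1 + w.2‖ ^ α) (.of_forall fun n => ?_) (.of_forall fun n => ?_) ?_ ?_
  · exact (continuous_const.sub (hcont n)).aestronglyMeasurable
  · exact .of_forall fun s _ => (tendsto_regJump_symbol hα hκ hsym _).2 n
  · exact (Continuous.rpow_const (by fun_prop) fun _ => Or.inr hα.1.le).intervalIntegrable _ _
  · exact .of_forall fun s _ => (tendsto_regJump_symbol hα hκ hsym _).1

/-- What is left of `exp (-kinAction α)` after removing the jump intensity `regJump E β κ 1`. -/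
noncomputable def kinRemainder (α κ : ℝ) (w : E × E) : ℝ :=
  exp (-(kinAction α w -
    ((∫ y, regJump E ((finrank ℝ E : ℝ) + α) κ 1 y) -
      kinSymbol (regJump E ((finrank ℝ E : ℝ) + α) κ 1) w)))

lemma integrable_kinRemainder [Nontrivial E] {α : ℝ} (hα : α ∈ Set.Ioo (0 : ℝ) 2) {κ : ℝ}
    (hκ : 0 < κ) : Integrable (kinRemainder (E := E) α κ) := by
  set β : ℝ := (finrank ℝ E : ℝ) + α with hβ
  have hintg : Integrable (regJump E β κ 1) :=
    integrable_regJump (by rw [hβ]; linarith [hα.1]) hκ one_pos le_rfl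
  refine ((integrable_exp_neg_kinAction hα.1).const_mul
    (exp (2 * ∫ y, regJump E β κ 1 y))).mono'
    (Continuous.aestronglyMeasurable ?_) (.of_forall fun w => ?_)
  · have := continuous_kinAction (E := E) hα.1
    have := continuous_kinSymbol hintg
    unfold kinRemainder
    fun_prop
  · rw [kinRemainder, norm_eq_abs, abs_exp, ← exp_add, exp_le_exp]
    have := (abs_le.1 (abs_kinSymbol_le (regJump_nonneg hκ one_pos) hintg w)).1
    linarith

lemma isPosCos_kinRemainder [Nontrivial E] {α : ℝ} (hα : α ∈ Set.Ioo (0 : ℝ) 2) {κ : ℝ}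
    (hκ : 0 < κ)
    (hsym : ∀ ζ : E, ∫ w : E, (1 - cos ⟪w, ζ⟫) * ‖w‖ ^ (-((finrank ℝ E : ℝ) + α)) = κ * ‖ζ‖ ^ α) :
    IsPosCos (kinRemainder (E := E) α κ) := by
  set β : ℝ := (finrank ℝ E : ℝ) + α with hβ
  have hβ0 : 0 ≤ β := by
    have := hα.1
    positivity
  have hdβ : (finrank ℝ E : ℝ) < β := by rw [hβ]; linarith [hα.1]
  have hε1 : ∀ n : ℕ, (1 : ℝ) / (n + 1) ≤ 1 := fun n => by
    rw [div_le_one (by positivity)]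
    linarith [(Nat.cast_nonneg n : (0 : ℝ) ≤ n)]
  have hintg : ∀ n : ℕ, Integrable (regJump E β κ (1 / (n + 1))) := fun n =>
    integrable_regJump hdβ hκ (by positivity) (hε1 n)
  have hint1 : Integrable (regJump E β κ 1) := integrable_regJump hdβ hκ one_pos le_rfl
  set k : ℕ → E → ℝ := fun n w => regJump E β κ (1 / (n + 1)) w - regJump E β κ 1 w with hk
  have hk0 : ∀ n w, 0 ≤ k n w := fun n w =>
    sub_nonneg.2 (regJump_anti hβ0 hκ (by positivity) (hε1 n) w)
  have hki : ∀ n, Integrable (k n) := fun n => (hintg n).sub hint1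
  have hkj : ∀ n ζ, jumpSymbol (k n) ζ =
      jumpSymbol (regJump E β κ (1 / (n + 1))) ζ - jumpSymbol (regJump E β κ 1) ζ := fun n ζ => by
    unfold jumpSymbol
    rw [← integral_sub (integrable_cos_inner_mul (hintg n) ζ) (integrable_cos_inner_mul hint1 ζ)]
    congr with w
    simp only [hk]
    ring
  have hkk : ∀ n w, kinSymbol (k n) w =
      kinSymbol (regJump E β κ (1 / (n + 1))) w - kinSymbol (regJump E β κ 1) w := fun n w => by
    have hc := continuous_jumpSymbol (hintg n)
    have hc1 := continuous_jumpSymbol hint1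
    unfold kinSymbol
    rw [← intervalIntegral.integral_sub (Continuous.intervalIntegrable (by fun_prop) _ _)
      (Continuous.intervalIntegrable (by fun_prop) _ _)]
    simp only [hkj]
  have hkΛ : ∀ n, ∫ y, k n y =
      (∫ y, regJump E β κ (1 / (n + 1)) y) - ∫ y, regJump E β κ 1 y := fun n =>
    integral_sub (hintg n) hint1
  have hgauss : ∀ m : ℕ, IsPosCos fun w : E × E =>
      kinRemainder α κ w * (exp (-(1 / ((m : ℝ) + 1)) * ‖w.1‖ ^ 2) *
        exp (-(1 / ((m : ℝ) + 1)) * ‖w.2‖ ^ 2)) := fun m => by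
    have hg := isPosCos_gaussian (E := E) (b := 1 / ((m : ℝ) + 1)) (by positivity)
    refine IsPosCos.of_tendsto
      (fun n => ((hg.exp_mul (hk0 n) (hki n)).const_mul (exp_pos (-∫ y, k n y)).le)) hg.1
      (fun n w => ?_) fun w => ?_
    · rw [← mul_assoc, ← exp_add, abs_of_nonneg (by positivity)]
      refine mul_le_of_le_one_left (by positivity) (exp_le_one_iff.2 ?_)
      linarith [(abs_le.1 (abs_kinSymbol_le (hk0 n) (hki n) w)).2]
    · simp only [← mul_assoc (exp (-∫ y, k _ y))]
      simp only [← exp_add (-∫ y, k _ y)]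
      refine Filter.Tendsto.mul_const _ ?_
      refine (continuous_exp.tendsto _).comp ?_
      have h := ((tendsto_regJump_kinSymbol hα hκ hsym w).sub_const
        ((∫ y, regJump E β κ 1 y) - kinSymbol (regJump E β κ 1) w)).neg
      refine h.congr fun n => ?_
      simp only [hkk, hkΛ, ← hβ]
      ring
  refine IsPosCos.of_tendsto hgauss (integrable_kinRemainder hα hκ) (fun m w => ?_) fun w => ?_
  · have : 0 ≤ kinRemainder α κ w := (exp_pos _).le
    rw [abs_of_nonneg (by positivity)]
    refine mul_le_of_le_one_right this ?_
    rw [← exp_add]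
    refine exp_le_one_iff.2 ?_
    have : 0 ≤ 1 / ((m : ℝ) + 1) := by positivity
    nlinarith [sq_nonneg ‖w.1‖, sq_nonneg ‖w.2‖]
  · have h0 : Filter.Tendsto (fun m : ℕ => -(1 / ((m : ℝ) + 1))) Filter.atTop (nhds 0) := by
      simpa using tendsto_one_div_add_atTop_nhds_zero_nat (𝕜 := ℝ).neg
    have h1 : ∀ r : ℝ, Filter.Tendsto (fun m : ℕ => exp (-(1 / ((m : ℝ) + 1)) * r))
        Filter.atTop (nhds 1) := fun r => by
      have := (continuous_exp.tendsto _).comp (h0.mul_const r)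
      rw [zero_mul, exp_zero] at this
      exact this
    simpa using ((h1 (‖w.1‖ ^ 2)).mul (h1 (‖w.2‖ ^ 2))).const_mul (kinRemainder α κ w)

end StableSymbol

section LowerBound

open Module

lemma mul_le_integral_of_le_on {g : ℝ → ℝ} (hg : Continuous g)
    (hg0 : ∀ s ∈ Set.Icc (0 : ℝ) 1, 0 ≤ g s) {a b m : ℝ} (ha : 0 ≤ a) (hab : a ≤ b) (hb : b ≤ 1)
    (hm : ∀ s ∈ Set.Icc a b, m ≤ g s) : (b - a) * m ≤ ∫ s in (0 : ℝ)..1, g s := by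
  calc (b - a) * m = ∫ s in a..b, m := by simp
    _ ≤ ∫ s in a..b, g s := intervalIntegral.integral_mono_on hab intervalIntegrable_const
        (hg.intervalIntegrable _ _) hm
    _ ≤ ∫ s in (0 : ℝ)..1, g s := by
        refine intervalIntegral.integral_mono_interval ha hab hb ?_ (hg.intervalIntegrable _ _)
        filter_upwards [ae_restrict_mem measurableSet_Ioc] with s hs
        exact hg0 s ⟨hs.1.le, hs.2⟩

variable {E : Type*} [NormedAddCommGroup E] [InnerProductSpace ℝ E] [FiniteDimensional ℝ E]
  [MeasurableSpace E] [BorelSpace E]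

lemma exists_le_cosTransform_near_zero {f : E × E → ℝ} (hf : Integrable f)
    (h0 : 0 < ∫ w, f w) :
    ∃ r > (0 : ℝ), r ≤ 1 ∧ ∃ c > (0 : ℝ), ∀ x v : E, ‖x‖ ≤ r → ‖v‖ ≤ r →
      c ≤ cosTransform f (x, v) := by
  have hval : cosTransform f 0 = ∫ w, f w := by simp [cosTransform]
  have hev : ∀ᶠ z in nhds (0 : E × E), (∫ w, f w) / 2 < cosTransform f z := by
    refine (continuous_cosTransform hf).continuousAt.eventually_const_lt ?_
    rw [hval]
    linarith
  obtain ⟨δ, hδ, hball⟩ := Metric.eventually_nhds_iff.1 hev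
  refine ⟨min (δ / 2) 1, by positivity, min_le_right _ _, _, half_pos h0, fun x v hx hv => ?_⟩
  refine (hball ?_).le
  rw [dist_zero_right, Prod.norm_mk]
  exact (max_le (hx.trans (min_le_left _ _)) (hv.trans (min_le_left _ _))).trans_lt (by linarith)

/-- Contribution of exactly two jumps, at times `s₁` and `s₂` separated by at least `1 / 4`. -/
lemma exists_two_jump_le {β κ : ℝ} (hβ : (finrank ℝ E : ℝ) < β) (hκ : 0 < κ)
    {f : E × E → ℝ} (hf : IsPosCos f) (h0 : 0 < ∫ w, f w) :
    ∃ A > (0 : ℝ), ∀ s₁ ∈ Set.Icc (0 : ℝ) 1, ∀ s₂ ∈ Set.Icc (0 : ℝ) 1, 1 / 4 ≤ |s₂ - s₁| →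
      ∀ (x v : E) (D Z : ℝ), 0 ≤ D → D ≤ Z → ‖v‖ ≤ Z → ‖x - s₁ • v‖ ≤ 2 * (1 + D) →
        A * ((1 + Z) ^ (-β) * (1 + D) ^ (-β)) ≤
          cosTransform (fun w => jumpSymbol (regJump E β κ 1) (s₁ • w.1 + w.2) *
            (jumpSymbol (regJump E β κ 1) (s₂ • w.1 + w.2) * f w)) (x, v) := by
  have hβ0 : 0 ≤ β := (Nat.cast_nonneg _).trans hβ.le
  have hk0 : ∀ w, 0 ≤ regJump E β κ 1 w := regJump_nonneg hκ one_pos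
  have hk : Integrable (regJump E β κ 1) := integrable_regJump hβ hκ one_pos le_rfl
  obtain ⟨r, hr, hr1, c, hc, hq⟩ := exists_le_cosTransform_near_zero hf.1 h0
  set b : ℝ := volume.real (Metric.ball (0 : E) (r / 2)) with hb
  have hb0 : 0 < b :=
    ENNReal.toReal_pos (Metric.measure_ball_pos volume _ (half_pos hr)).ne' measure_ball_lt_top.ne
  have hmono : ∀ {p q : ℝ}, 0 < p → p ≤ q → κ⁻¹ * q ^ (-β) ≤ κ⁻¹ * p ^ (-β) := fun hp hpq => by
    have := rpow_le_rpow_of_nonpos hp hpq (by linarith : -β ≤ 0)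
    gcongr
  have hone : ∀ s ∈ Set.Icc (0 : ℝ) 1, ∀ x v : E, ‖x - s • v‖ ≤ r / 2 →
      c / 2 * (κ⁻¹ * (2 + ‖v‖) ^ (-β)) * b ≤
        cosTransform (fun w => jumpSymbol (regJump E β κ 1) (s • w.1 + w.2) * f w) (x, v) := by
    intro s hs x v hxv
    refine le_cosTransform_jumpSymbol_mul hk0 hk hf s (x, v) v (r / 2) hc.le (by positivity)
      (fun y hy => ?_) fun y hy => ?_
    · rw [mem_ball_iff_norm] at hy
      refine hq _ _ ?_ ?_
      · have e : x - s • y = (x - s • v) - s • (y - v) := by module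
        have h2 : ‖s • (y - v)‖ ≤ ‖y - v‖ := by
          rw [norm_smul, norm_of_nonneg hs.1]
          exact mul_le_of_le_one_left (norm_nonneg _) hs.2
        change ‖x - s • y‖ ≤ r
        rw [e]
        linarith [norm_sub_le (x - s • v) (s • (y - v))]
      · change ‖v - y‖ ≤ r
        rw [norm_sub_rev]
        linarith
    · rw [mem_ball_iff_norm] at hy
      refine hmono (by positivity) ?_
      have : ‖y‖ ≤ ‖v‖ + ‖y - v‖ := by simpa using norm_add_le v (y - v)
      linarith
  refine ⟨(c / 2 * (κ⁻¹ * 11 ^ (-β)) * b) / 2 * (κ⁻¹ * 10 ^ (-β)) * b, by positivity, ?_⟩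
  intro s₁ hs₁ s₂ hs₂ hs x v D Z hD hDZ hvZ hxv
  set u : E := (s₂ - s₁)⁻¹ • (x - s₁ • v) with hu
  have hs0 : s₂ - s₁ ≠ 0 := abs_pos.1 (by linarith)
  have hsu : (s₂ - s₁) • u = x - s₁ • v := by rw [hu, smul_smul, mul_inv_cancel₀ hs0, one_smul]
  have hunorm : ‖u‖ ≤ 8 * (1 + D) := by
    have h1 : |s₂ - s₁| * ‖u‖ ≤ 2 * (1 + D) := by
      rw [← norm_eq_abs, ← norm_smul, hsu]
      exact hxv
    nlinarith [norm_nonneg u]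
  have hs1 : |s₂ - s₁| ≤ 1 := abs_le.2 ⟨by linarith [hs₁.2, hs₂.1], by linarith [hs₁.1, hs₂.2]⟩
  have hv' : ∀ y ∈ Metric.ball (v - u) (r / 2), ‖v - y‖ ≤ 8 * (1 + D) + 1 := fun y hy => by
    rw [mem_ball_iff_norm] at hy
    have e : v - y = u - (y - (v - u)) := by abel
    rw [e]
    linarith [norm_sub_le u (y - (v - u))]
  have key := le_cosTransform_jumpSymbol_mul hk0 hk (hf.jumpSymbol_mul hk0 hk s₂) s₁ (x, v)
    (v - u) (r / 2) (A := c / 2 * (κ⁻¹ * (11 * (1 + D)) ^ (-β)) * b)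
    (K := κ⁻¹ * (10 * (1 + Z)) ^ (-β)) (by positivity)
    (mul_nonneg (inv_nonneg.2 hκ.le) (rpow_nonneg (by linarith) _))
    (fun y hy => ?_) fun y hy => ?_
  · rw [← hb, mul_rpow (by norm_num) (by linarith), mul_rpow (by norm_num) (by linarith)] at key
    refine le_trans (le_of_eq ?_) key
    ring
  · have h1 : ‖(x - s₁ • y) - s₂ • (v - y)‖ ≤ r / 2 := by
      have e : (x - s₁ • y) - s₂ • (v - y) = (s₂ - s₁) • (y - (v - u)) := by
        rw [smul_sub (s₂ - s₁) y, smul_sub (s₂ - s₁) v, hsu]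
        module
      rw [mem_ball_iff_norm] at hy
      rw [e, norm_smul, norm_eq_abs]
      nlinarith [norm_nonneg (y - (v - u))]
    refine le_trans ?_ (hone s₂ hs₂ _ _ h1)
    have := hmono (p := 2 + ‖v - y‖) (q := 11 * (1 + D)) (by positivity)
      (by linarith [hv' y hy])
    gcongr
  · refine hmono (by positivity) ?_
    have : ‖y‖ ≤ ‖v‖ + ‖v - y‖ := by simpa using norm_sub_le v (v - y)
    linarith [hv' y hy]

lemma cosTransform_jumpSymbol_mul_kinSymbol_mul {k : E → ℝ} (hk0 : ∀ w, 0 ≤ k w)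
    (hk : Integrable k) {f : E × E → ℝ} (hf : Integrable f) (s₁ : ℝ) (z : E × E) :
    cosTransform (fun w => jumpSymbol k (s₁ • w.1 + w.2) * (kinSymbol k w * f w)) z =
      ∫ s₂ in (0 : ℝ)..1, cosTransform (fun w => jumpSymbol k (s₁ • w.1 + w.2) *
        (jumpSymbol k (s₂ • w.1 + w.2) * f w)) z := by
  have h := cosTransform_kinSymbol_mul hk0 hk (integrable_jumpSymbol_mul hk0 hk hf s₁) z
  have e : ∀ g : E × E → ℝ, (fun w : E × E => g w * (jumpSymbol k (s₁ • w.1 + w.2) * f w)) =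
      fun w => jumpSymbol k (s₁ • w.1 + w.2) * (g w * f w) :=
    fun g => funext fun w => mul_left_comm _ _ _
  rw [e] at h
  rw [h]
  exact intervalIntegral.integral_congr fun s₂ _ =>
    congrArg (fun g => cosTransform g z) (e fun w => jumpSymbol k (s₂ • w.1 + w.2))

lemma cosTransform_kinSymbol_sq_mul {k : E → ℝ} (hk0 : ∀ w, 0 ≤ k w) (hk : Integrable k)
    {f : E × E → ℝ} (hf : Integrable f) (z : E × E) :
    cosTransform (fun w => kinSymbol k w ^ 2 * f w) z =
      ∫ s₁ in (0 : ℝ)..1, ∫ s₂ in (0 : ℝ)..1,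
        cosTransform (fun w => jumpSymbol k (s₁ • w.1 + w.2) *
          (jumpSymbol k (s₂ • w.1 + w.2) * f w)) z := by
  simp only [pow_two, mul_assoc]
  rw [cosTransform_kinSymbol_mul hk0 hk (integrable_kinSymbol_mul hk0 hk hf)]
  exact intervalIntegral.integral_congr fun s₁ _ =>
    cosTransform_jumpSymbol_mul_kinSymbol_mul hk0 hk hf s₁ z

lemma exists_le_cosTransform_kinSymbol_sq {β κ : ℝ} (hβ : (finrank ℝ E : ℝ) < β) (hκ : 0 < κ)
    {f : E × E → ℝ} (hf : IsPosCos f) (h0 : 0 < ∫ w, f w) :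
    ∃ A > (0 : ℝ), ∀ x v : E,
      A * ((1 + √(‖x‖ ^ 2 + ‖v‖ ^ 2)) ^ (-(1 + β)) *
        (1 + ⨅ s : Set.Icc (0 : ℝ) 1, ‖x - (s : ℝ) • v‖) ^ (1 - β)) ≤
      cosTransform (fun w => kinSymbol (regJump E β κ 1) w ^ 2 * f w) (x, v) := by
  obtain ⟨A, hA, hjump⟩ := exists_two_jump_le hβ hκ hf h0
  have hk0 : ∀ w, 0 ≤ regJump E β κ 1 w := regJump_nonneg hκ one_pos
  have hk : Integrable (regJump E β κ 1) := integrable_regJump hβ hκ one_pos le_rfl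
  refine ⟨A / 8, by positivity, fun x v => ?_⟩
  set Z : ℝ := √(‖x‖ ^ 2 + ‖v‖ ^ 2) with hZ
  set D : ℝ := ⨅ s : Set.Icc (0 : ℝ) 1, ‖x - (s : ℝ) • v‖ with hDdef
  have hD0 : 0 ≤ D := Real.iInf_nonneg fun _ => norm_nonneg _
  have hxZ : ‖x‖ ≤ Z := le_sqrt_of_sq_le (by nlinarith [sq_nonneg ‖v‖])
  have hvZ : ‖v‖ ≤ Z := le_sqrt_of_sq_le (by nlinarith [sq_nonneg ‖x‖])
  have hbdd : BddBelow (Set.range fun s : Set.Icc (0 : ℝ) 1 => ‖x - (s : ℝ) • v‖) :=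
    ⟨0, by rintro _ ⟨s, rfl⟩; exact norm_nonneg _⟩
  have hDZ : D ≤ Z := by
    refine le_trans ?_ hxZ
    simpa using ciInf_le hbdd ⟨0, by simp⟩
  have : Nonempty (Set.Icc (0 : ℝ) 1) := ⟨⟨0, by simp⟩⟩
  obtain ⟨⟨σ, hσ⟩, hσD⟩ : ∃ s : Set.Icc (0 : ℝ) 1, ‖x - (s : ℝ) • v‖ < D + 1 / 2 :=
    exists_lt_of_ciInf_lt (by rw [← hDdef]; linarith)
  simp only at hσD
  set ρ : ℝ := (1 + D) / (2 * (1 + Z)) with hρ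
  have hρ0 : 0 ≤ ρ := by positivity
  have hZ0 : 0 < 1 + Z := by linarith
  have hρZ : ρ * (1 + Z) = (1 + D) / 2 := by
    rw [hρ]
    field_simp
  have hρ1 : ρ ≤ 1 / 2 := by
    rw [hρ, div_le_div_iff₀ (by positivity) two_pos]
    linarith
  have hnear : ∀ s, |s - σ| ≤ ρ → ‖x - s • v‖ ≤ 2 * (1 + D) := fun s hs => by
    have e : x - s • v = (x - σ • v) - (s - σ) • v := by module
    have h1 : ‖(s - σ) • v‖ ≤ ρ * (1 + Z) := by
      rw [norm_smul, norm_eq_abs]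
      exact mul_le_mul hs (by linarith) (norm_nonneg _) hρ0
    rw [e]
    linarith [norm_sub_le (x - σ • v) ((s - σ) • v)]
  obtain ⟨a, ha0, ha1, ha⟩ : ∃ a, 0 ≤ a ∧ a + ρ ≤ 1 ∧ ∀ s ∈ Set.Icc a (a + ρ), |s - σ| ≤ ρ := by
    rcases le_total σ (1 / 2) with h | h
    · exact ⟨σ, hσ.1, by linarith, fun s hs =>
        abs_le.2 ⟨by linarith [hs.1], by linarith [hs.2]⟩⟩
    · exact ⟨σ - ρ, by linarith, by linarith [hσ.2], fun s hs =>
        abs_le.2 ⟨by linarith [hs.1], by linarith [hs.2]⟩⟩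
  set B : ℝ := A * ((1 + Z) ^ (-β) * (1 + D) ^ (-β)) with hB
  have hB0 : 0 ≤ B := by positivity
  have hpos₂ : ∀ s₁ s₂ : ℝ, 0 ≤ cosTransform (fun w : E × E =>
      jumpSymbol (regJump E β κ 1) (s₁ • w.1 + w.2) *
        (jumpSymbol (regJump E β κ 1) (s₂ • w.1 + w.2) * f w)) (x, v) := fun s₁ s₂ =>
    ((hf.jumpSymbol_mul hk0 hk s₂).jumpSymbol_mul hk0 hk s₁).2 _
  have hinner : ∀ s₁ : ℝ, (∫ s₂ in (0 : ℝ)..1,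
      cosTransform (fun w : E × E => jumpSymbol (regJump E β κ 1) (s₁ • w.1 + w.2) *
        (jumpSymbol (regJump E β κ 1) (s₂ • w.1 + w.2) * f w)) (x, v)) =
      cosTransform (fun w => jumpSymbol (regJump E β κ 1) (s₁ • w.1 + w.2) *
        (kinSymbol (regJump E β κ 1) w * f w)) (x, v) := fun s₁ =>
    (cosTransform_jumpSymbol_mul_kinSymbol_mul hk0 hk hf.1 s₁ (x, v)).symm
  have hcont₂ : ∀ s₁ : ℝ, Continuous fun s₂ : ℝ => cosTransform (fun w : E × E =>
      jumpSymbol (regJump E β κ 1) (s₁ • w.1 + w.2) *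
        (jumpSymbol (regJump E β κ 1) (s₂ • w.1 + w.2) * f w)) (x, v) := fun s₁ => by
    simp only [mul_left_comm (jumpSymbol _ (s₁ • _ + _))]
    exact continuous_cosTransform_jumpSymbol_mul hk0 hk
      (integrable_jumpSymbol_mul hk0 hk hf.1 s₁) _
  have hlow : ∀ s₁ ∈ Set.Icc a (a + ρ), 1 / 4 * B ≤ ∫ s₂ in (0 : ℝ)..1,
      cosTransform (fun w : E × E => jumpSymbol (regJump E β κ 1) (s₁ • w.1 + w.2) *
        (jumpSymbol (regJump E β κ 1) (s₂ • w.1 + w.2) * f w)) (x, v) := fun s₁ hs₁ => by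
    have hs₁' : s₁ ∈ Set.Icc (0 : ℝ) 1 := ⟨ha0.trans hs₁.1, hs₁.2.trans ha1⟩
    have hs₁D := hnear s₁ (ha s₁ hs₁)
    rcases le_total s₁ (1 / 2) with h | h
    · have := mul_le_integral_of_le_on (hcont₂ s₁) (fun s _ => hpos₂ s₁ s) (a := 3 / 4) (b := 1)
        (m := B) (by norm_num) (by norm_num) le_rfl fun s₂ hs₂ =>
          hjump s₁ hs₁' s₂ ⟨by linarith [hs₂.1], hs₂.2⟩
            (le_abs.2 (Or.inl (by linarith [hs₂.1]))) x v D Z hD0 hDZ hvZ hs₁D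
      norm_num at this ⊢
      exact this
    · have := mul_le_integral_of_le_on (hcont₂ s₁) (fun s _ => hpos₂ s₁ s) (a := 0) (b := 1 / 4)
        (m := B) le_rfl (by norm_num) (by norm_num) fun s₂ hs₂ =>
          hjump s₁ hs₁' s₂ ⟨hs₂.1, by linarith [hs₂.2]⟩
            (le_abs.2 (Or.inr (by linarith [hs₂.2]))) x v D Z hD0 hDZ hvZ hs₁D
      norm_num at this ⊢
      exact this
  rw [cosTransform_kinSymbol_sq_mul hk0 hk hf.1]
  have hfin := mul_le_integral_of_le_on
    (g := fun s₁ => ∫ s₂ in (0 : ℝ)..1,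
      cosTransform (fun w : E × E => jumpSymbol (regJump E β κ 1) (s₁ • w.1 + w.2) *
        (jumpSymbol (regJump E β κ 1) (s₂ • w.1 + w.2) * f w)) (x, v))
    (by
      simp only [hinner]
      exact continuous_cosTransform_jumpSymbol_mul hk0 hk (integrable_kinSymbol_mul hk0 hk hf.1) _)
    (fun s₁ _ => intervalIntegral.integral_nonneg zero_le_one fun s₂ _ => hpos₂ s₁ s₂)
    ha0 (by linarith) ha1 hlow
  refine le_trans (le_of_eq ?_) hfin
  have hD1 : 0 < 1 + D := by linarith
  rw [hB, hρ, sub_eq_add_neg 1 β, neg_add, rpow_add hD1, rpow_add hZ0, rpow_one, rpow_neg_one]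
  field_simp
  ring

/-- Lower bound at unit time, up to the Fourier normalisation. -/
lemma exists_le_cosTransform_exp_neg_kinAction [Nontrivial E] {α : ℝ}
    (hα : α ∈ Set.Ioo (0 : ℝ) 2) :
    ∃ A > (0 : ℝ), ∀ x v : E,
      A * ((1 + √(‖x‖ ^ 2 + ‖v‖ ^ 2)) ^ (-(1 + ((finrank ℝ E : ℝ) + α))) *
        (1 + ⨅ s : Set.Icc (0 : ℝ) 1, ‖x - (s : ℝ) • v‖) ^ (1 - ((finrank ℝ E : ℝ) + α))) ≤
      cosTransform (fun w => exp (-kinAction α w)) (x, v) := by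
  obtain ⟨κ, hκ, hsym⟩ := exists_stableSymbol_eq (E := E) hα
  set β : ℝ := (finrank ℝ E : ℝ) + α with hβ
  have hdβ : (finrank ℝ E : ℝ) < β := by rw [hβ]; linarith [hα.1]
  have hf := isPosCos_kinRemainder hα hκ hsym
  have h0 : 0 < ∫ w : E × E, kinRemainder α κ w := integral_exp_pos hf.1
  have hk0 : ∀ w, 0 ≤ regJump E β κ 1 w := regJump_nonneg hκ one_pos
  have hk : Integrable (regJump E β κ 1) := integrable_regJump hdβ hκ one_pos le_rfl
  obtain ⟨A, hA, hle⟩ := exists_le_cosTransform_kinSymbol_sq hdβ hκ hf h0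
  set Λ : ℝ := ∫ y, regJump E β κ 1 y with hΛ
  refine ⟨exp (-Λ) * (A / 2), by positivity, fun x v => ?_⟩
  have hfac : (fun w : E × E => exp (-kinAction α w)) = fun w =>
      exp (-Λ) * (exp (kinSymbol (regJump E β κ 1) w) * kinRemainder α κ w) := by
    ext w
    rw [kinRemainder, ← exp_add, ← exp_add, ← hβ, ← hΛ]
    congr 1
    ring
  rw [hfac, cosTransform_const_mul, mul_assoc]
  gcongr
  have h1 := hle x v
  have h2 := hf.half_sq_le_exp hk0 hk (x, v)
  linarith

lemma integral_prod_comp_smul (F : E × E → ℝ) {a b : ℝ} (ha : 0 < a) (hb : 0 < b) :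
    ∫ w : E × E, F w =
      a ^ finrank ℝ E * b ^ finrank ℝ E * ∫ w : E × E, F (a • w.1, b • w.2) := by
  have hmap : Measure.map (Prod.map (fun x : E => a • x) fun x : E => b • x)
      (volume : Measure (E × E)) =
      (ENNReal.ofReal |(a ^ finrank ℝ E)⁻¹| * ENNReal.ofReal |(b ^ finrank ℝ E)⁻¹|) •
        (volume : Measure (E × E)) := by
    rw [Measure.volume_eq_prod, ← Measure.map_prod_map _ _ (measurable_const_smul a)
      (measurable_const_smul b), Measure.map_addHaar_smul _ ha.ne',
      Measure.map_addHaar_smul _ hb.ne', Measure.prod_smul_left, Measure.prod_smul_right,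
      smul_smul]
  have hemb : MeasurableEmbedding (Prod.map (fun x : E => a • x) fun x : E => b • x) :=
    ((Homeomorph.smulOfNeZero a ha.ne').prodCongr
      (Homeomorph.smulOfNeZero b hb.ne')).measurableEmbedding
  have h := hemb.integral_map (μ := (volume : Measure (E × E))) F
  rw [hmap, integral_smul_measure, ENNReal.toReal_mul, ENNReal.toReal_ofReal (abs_nonneg _),
    ENNReal.toReal_ofReal (abs_nonneg _), abs_of_pos (by positivity), abs_of_pos (by positivity),
    smul_eq_mul] at h
  simp only [Prod.map] at h
  rw [← h]
  field_simp

end LowerBound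

/-- Kinetic scaling reduces the heat kernel to unit time. -/
lemma kinHeat_eq_cosTransform (d : ℕ) {α t : ℝ} (hα : 0 < α) (ht : 0 < t)
    (x v : EuclideanSpace ℝ (Fin d)) :
    kinHeat d α t x v = (2 * π) ^ (-(2 * (d : ℝ))) * (t ^ (-(2 * (d : ℝ)) / α - d) *
      cosTransform (fun w => exp (-kinAction α w)) (t ^ (-α⁻¹ - 1) • x, t ^ (-α⁻¹) • v)) := by
  set a : ℝ := t ^ (-α⁻¹ - 1) with ha
  set b : ℝ := t ^ (-α⁻¹) with hb
  have ha0 : 0 < a := rpow_pos_of_pos ht _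
  have hb0 : 0 < b := rpow_pos_of_pos ht _
  have hab : t * a = b := by
    rw [ha, hb]
    nth_rewrite 1 [← rpow_one t]
    rw [← rpow_add ht]
    ring_nf
  have hbα : t * b ^ α = 1 := by
    rw [hb, ← rpow_mul ht.le, neg_mul, inv_mul_cancel₀ hα.ne', rpow_neg_one,
      mul_inv_cancel₀ ht.ne']
  have hpow : a ^ d * b ^ d = t ^ (-(2 * (d : ℝ)) / α - d) := by
    rw [ha, hb, ← rpow_natCast, ← rpow_natCast, ← rpow_mul ht.le, ← rpow_mul ht.le,
      ← rpow_add ht]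
    congr 1
    field_simp
    ring
  have hact : ∀ w : EuclideanSpace ℝ (Fin d) × EuclideanSpace ℝ (Fin d),
      ∫ s in (0 : ℝ)..t, ‖s • (a • w.1) + b • w.2‖ ^ α = kinAction α w := fun w => by
    have h := intervalIntegral.smul_integral_comp_mul_left (a := 0) (b := 1)
      (fun s : ℝ => ‖s • (a • w.1) + b • w.2‖ ^ α) t
    rw [mul_zero, mul_one] at h
    rw [← h, smul_eq_mul, kinAction, ← intervalIntegral.integral_const_mul]
    congr with s
    have e : (t * s) • (a • w.1) + b • w.2 = b • (s • w.1 + w.2) := by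
      rw [← hab]
      module
    rw [e, norm_smul, norm_of_nonneg hb0.le, mul_rpow hb0.le (norm_nonneg _), ← mul_assoc, hbα,
      one_mul]
  rw [kinHeat, integral_prod_comp_smul _ ha0 hb0, finrank_euclideanSpace_fin, hpow, cosTransform]
  simp only [hact, inner_smul_left, inner_smul_right, conj_trivial]

/-- sharp lower bound for the kinetic heat kernel; in particular it is
strictly positive. -/
theorem stmt_1 (d : ℕ) (hd : 1 ≤ d) (α : ℝ) (hα : α ∈ Set.Ioo (0 : ℝ) 2) :
    ∃ C ≥ (1 : ℝ), ∀ t > (0 : ℝ), ∀ x v : EuclideanSpace ℝ (Fin d),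
      C⁻¹ * t ^ (-(2 * (d : ℝ)) / α - d) *
          kinN d ((d : ℝ) + α) ((t ^ (-α⁻¹ - 1)) • x) ((t ^ (-α⁻¹)) • v) ≤
        kinHeat d α t x v ∧ 0 < kinHeat d α t x v := by
  have : Nonempty (Fin d) := ⟨⟨0, hd⟩⟩
  obtain ⟨A, hA, hle⟩ :=
    exists_le_cosTransform_exp_neg_kinAction (E := EuclideanSpace ℝ (Fin d)) hα
  rw [finrank_euclideanSpace_fin] at hle
  set P : ℝ := (2 * π) ^ (-(2 * (d : ℝ))) with hP
  have hP0 : 0 < P := by positivity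
  refine ⟨max 1 (P * A)⁻¹, le_max_left _ _, fun t ht x v => ?_⟩
  have hC : (max 1 (P * A)⁻¹)⁻¹ ≤ P * A := by
    rw [inv_le_comm₀ (by positivity) (by positivity)]
    exact le_max_right _ _
  have hC0 : 0 < (max 1 (P * A)⁻¹)⁻¹ := by positivity
  set N : ℝ := kinN d ((d : ℝ) + α) ((t ^ (-α⁻¹ - 1)) • x) ((t ^ (-α⁻¹)) • v) with hN
  have hN0 : 0 < N := by
    have h0 : 0 ≤ ⨅ s : Set.Icc (0 : ℝ) 1, ‖(t ^ (-α⁻¹ - 1)) • x - (s : ℝ) • (t ^ (-α⁻¹)) • v‖ :=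
      Real.iInf_nonneg fun _ => norm_nonneg _
    rw [hN, kinN]
    positivity
  have ht0 : 0 < t ^ (-(2 * (d : ℝ)) / α - d) := rpow_pos_of_pos ht _
  have hmain : (max 1 (P * A)⁻¹)⁻¹ * t ^ (-(2 * (d : ℝ)) / α - d) * N ≤ kinHeat d α t x v := by
    rw [kinHeat_eq_cosTransform d hα.1 ht]
    calc _ ≤ P * A * t ^ (-(2 * (d : ℝ)) / α - d) * N := by gcongr
      _ = P * (t ^ (-(2 * (d : ℝ)) / α - d) * (A * N)) := by ring
      _ ≤ _ := by
        gcongr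
        exact hle _ _
  exact ⟨hmain, lt_of_lt_of_le (by positivity) hmain⟩
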